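/- Let Σ be an interaction-free set of (relational) matching dependencies and D₀ any initial instance. Then there is a unique (D₀,Σ)-clean instance: every maximal chase sequence of MD enforcements starting from D₀ terminates in the same stable instance. -/

import Mathlib

namespace ERBlox

/-- A relational matching dependency over attribute set `Attr`.  Besides the two
leading tuple variables (`Sum.inl 0`, `Sum.inl 1`) it may use `nExtra` additional
existentially quantified tuple variables (for the relational atoms of `ψ`).
`simAtoms` are the (proper) similarity atoms and `eqAtoms` the implicit equality
atoms (joins) of its LHS; the RHS identifies the values of the two leading tuples
on the pair `rhs` of attributes. -/
structure RelMD (Attr : Type) where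
  nExtra : ℕ
  simAtoms : List (((Fin 2 ⊕ Fin nExtra) × Attr) × ((Fin 2 ⊕ Fin nExtra) × Attr))
  eqAtoms  : List (((Fin 2 ⊕ Fin nExtra) × Attr) × ((Fin 2 ⊕ Fin nExtra) × Attr))
  rhs : Attr × Attr

variable {Tid Attr Val : Type}

/-- The set of attributes appearing in (proper or implicit-equality) similarity
atoms on the LHS of a relational MD. -/
def ALHS (φ : RelMD Attr) : Set Attr :=
  {A | (∃ a ∈ φ.simAtoms, a.1.2 = A ∨ a.2.2 = A) ∨ (∃ a ∈ φ.eqAtoms, a.1.2 = A ∨ a.2.2 = A)}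

/-- The set of attributes appearing in the identity atom on the RHS. -/
def ARHS (φ : RelMD Attr) : Set Attr := {φ.rhs.1, φ.rhs.2}

/-- Interaction-freeness of a set of relational MDs. -/
def InteractionFree (Sgm : Set (RelMD Attr)) : Prop :=
  ∀ φ₁ ∈ Sgm, ∀ φ₂ ∈ Sgm, ALHS φ₁ ∩ ARHS φ₂ = ∅

/-- A matching function is idempotent, commutative and associative. -/
def IsMatchingFn (m : Val → Val → Val) : Prop :=
  (∀ a, m a a = a) ∧ (∀ a b, m a b = m b a) ∧ (∀ a b c, m (m a b) c = m a (m b c))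

/-- The LHS of relational MD `φ` holds in instance `D` under the assignment `σ`
of tuples to its tuple variables. -/
def lhsHoldsOn (sim : Val → Val → Prop) (φ : RelMD Attr) (D : Tid → Attr → Val)
    (σ : (Fin 2 ⊕ Fin φ.nExtra) → Tid) : Prop :=
  (∀ a ∈ φ.simAtoms, sim (D (σ a.1.1) a.1.2) (D (σ a.2.1) a.2.2)) ∧
  (∀ a ∈ φ.eqAtoms, D (σ a.1.1) a.1.2 = D (σ a.2.1) a.2.2)

/-- `LHS(φ)` is true in the set `S` of tuples of `D`. -/
def lhsTrueIn (sim : Val → Val → Prop) (φ : RelMD Attr) (D : Tid → Attr → Val)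
    (S : Set Tid) : Prop :=
  ∃ σ : (Fin 2 ⊕ Fin φ.nExtra) → Tid, (∀ v, σ v ∈ S) ∧ lhsHoldsOn sim φ D σ

/-- The combination of a set of relational MDs and an instance `D` is SFAI. -/
def SFAI (sim : Val → Val → Prop) (Sgm : Set (RelMD Attr)) (D : Tid → Attr → Val) : Prop :=
  InteractionFree Sgm ∨
    ∀ φ₁ ∈ Sgm, ∀ φ₂ ∈ Sgm, ∀ A ∈ ALHS φ₂ ∩ ARHS φ₁, ∀ S₁ S₂ : Set Tid,
      (S₁ ∩ S₂).Nonempty → ¬ lhsTrueIn sim φ₁ D S₁ ∨ ¬ lhsTrueIn sim φ₂ D S₂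

/-- `D'` is the immediate result of enforcing relational MD `φ` on `D` (for some
witnessing assignment whose leading tuples have differing RHS values). -/
def EnforceStep (sim : Val → Val → Prop) (m : Val → Val → Val) (φ : RelMD Attr)
    (D D' : Tid → Attr → Val) : Prop :=
  ∃ σ : (Fin 2 ⊕ Fin φ.nExtra) → Tid,
    lhsHoldsOn sim φ D σ ∧
    D (σ (Sum.inl 0)) φ.rhs.1 ≠ D (σ (Sum.inl 1)) φ.rhs.2 ∧
    D' (σ (Sum.inl 0)) φ.rhs.1 = m (D (σ (Sum.inl 0)) φ.rhs.1) (D (σ (Sum.inl 1)) φ.rhs.2) ∧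
    D' (σ (Sum.inl 1)) φ.rhs.2 = m (D (σ (Sum.inl 0)) φ.rhs.1) (D (σ (Sum.inl 1)) φ.rhs.2) ∧
    ∀ t X, ¬ ((t = σ (Sum.inl 0) ∧ X = φ.rhs.1) ∨ (t = σ (Sum.inl 1) ∧ X = φ.rhs.2)) →
      D' t X = D t X

/-- One chase step: enforcement of some MD of `Sgm`. -/
def ChaseStep (sim : Val → Val → Prop) (m : Val → Val → Val) (Sgm : Set (RelMD Attr))
    (D D' : Tid → Attr → Val) : Prop :=
  ∃ φ ∈ Sgm, EnforceStep sim m φ D D'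

/-- An instance is stable when no MD of `Sgm` is applicable. -/
def Stable (sim : Val → Val → Prop) (Sgm : Set (RelMD Attr)) (D : Tid → Attr → Val) : Prop :=
  ∀ φ ∈ Sgm, ∀ σ : (Fin 2 ⊕ Fin φ.nExtra) → Tid,
    ¬ (lhsHoldsOn sim φ D σ ∧ D (σ (Sum.inl 0)) φ.rhs.1 ≠ D (σ (Sum.inl 1)) φ.rhs.2)

/-- `D` is a `(D₀,Sgm)`-clean instance. -/
def Clean (sim : Val → Val → Prop) (m : Val → Val → Val) (Sgm : Set (RelMD Attr))
    (D₀ D : Tid → Attr → Val) : Prop :=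
  Relation.ReflTransGen (ChaseStep sim m Sgm) D₀ D ∧ Stable sim Sgm D

theorem lhsHoldsOn_congr {sim : Val → Val → Prop} {φ : RelMD Attr} {D D' : Tid → Attr → Val}
    (h : ∀ t, ∀ A ∈ ALHS φ, D' t A = D t A) (σ : (Fin 2 ⊕ Fin φ.nExtra) → Tid) :
    lhsHoldsOn sim φ D' σ ↔ lhsHoldsOn sim φ D σ := by
  unfold lhsHoldsOn
  refine and_congr (forall₂_congr fun a ha => ?_) (forall₂_congr fun a ha => ?_)
  · rw [h _ _ (Or.inl ⟨a, ha, Or.inl rfl⟩), h _ _ (Or.inl ⟨a, ha, Or.inr rfl⟩)]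
  · rw [h _ _ (Or.inr ⟨a, ha, Or.inl rfl⟩), h _ _ (Or.inr ⟨a, ha, Or.inr rfl⟩)]

/-- Under interaction-freeness, a chase step changes no value that an LHS looks at. -/
theorem ChaseStep.eq_of_mem_ALHS {sim : Val → Val → Prop} {m : Val → Val → Val}
    {Sgm : Set (RelMD Attr)} {D D' : Tid → Attr → Val} (hIF : InteractionFree Sgm)
    (h : ChaseStep sim m Sgm D D') {φ : RelMD Attr} (hφ : φ ∈ Sgm) (t : Tid) {A : Attr}
    (hA : A ∈ ALHS φ) : D' t A = D t A := by
  obtain ⟨ψ, hψ, σ, -, -, -, -, hrest⟩ := h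
  refine hrest t A fun hc => ?_
  have hmem : A ∈ ALHS φ ∩ ARHS ψ :=
    ⟨hA, hc.elim (fun h => Or.inl h.2) (fun h => Or.inr h.2)⟩
  rwa [hIF φ hφ ψ hψ] at hmem

theorem lhsHoldsOn_iff_of_chase {sim : Val → Val → Prop} {m : Val → Val → Val}
    {Sgm : Set (RelMD Attr)} {D₀ D : Tid → Attr → Val} (hIF : InteractionFree Sgm)
    (h : Relation.ReflTransGen (ChaseStep sim m Sgm) D₀ D) {φ : RelMD Attr} (hφ : φ ∈ Sgm)
    (σ : (Fin 2 ⊕ Fin φ.nExtra) → Tid) :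
    lhsHoldsOn sim φ D σ ↔ lhsHoldsOn sim φ D₀ σ := by
  induction h with
  | refl => rfl
  | tail _ hstep ih =>
    exact (lhsHoldsOn_congr (fun t A hA => hstep.eq_of_mem_ALHS hIF hφ t hA) σ).trans ih

theorem exists_enforceStep {sim : Val → Val → Prop} (m : Val → Val → Val) {φ : RelMD Attr}
    {D : Tid → Attr → Val} {σ : (Fin 2 ⊕ Fin φ.nExtra) → Tid} (hσ : lhsHoldsOn sim φ D σ)
    (hne : D (σ (Sum.inl 0)) φ.rhs.1 ≠ D (σ (Sum.inl 1)) φ.rhs.2) :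
    ∃ D', EnforceStep sim m φ D D' := by
  classical
  refine ⟨fun t X => if (t = σ (Sum.inl 0) ∧ X = φ.rhs.1) ∨ (t = σ (Sum.inl 1) ∧ X = φ.rhs.2)
    then m (D (σ (Sum.inl 0)) φ.rhs.1) (D (σ (Sum.inl 1)) φ.rhs.2) else D t X,
    σ, hσ, hne, ?_, ?_, ?_⟩
  · simp
  · simp
  · intro t X h
    exact if_neg h

section SemilatticeSup

variable [SemilatticeSup Val] {sim : Val → Val → Prop} {Sgm : Set (RelMD Attr)}
  {D₀ D D' : Tid → Attr → Val}

theorem ChaseStep.lt (h : ChaseStep sim (· ⊔ ·) Sgm D D') : D < D' := by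
  obtain ⟨φ, -, σ, -, hne, h0, h1, hrest⟩ := h
  refine lt_of_le_of_ne (fun t X => ?_) ?_
  · by_cases hc : (t = σ (Sum.inl 0) ∧ X = φ.rhs.1) ∨ (t = σ (Sum.inl 1) ∧ X = φ.rhs.2)
    · obtain ⟨rfl, rfl⟩ | ⟨rfl, rfl⟩ := hc
      · rw [h0]; exact le_sup_left
      · rw [h1]; exact le_sup_right
    · exact (hrest t X hc).ge
  · rintro rfl
    exact hne (h0.trans h1.symm)

theorem le_of_chase (h : Relation.ReflTransGen (ChaseStep sim (· ⊔ ·) Sgm) D₀ D) : D₀ ≤ D := by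
  induction h with
  | refl => exact le_rfl
  | tail _ hstep ih => exact ih.trans hstep.lt.le

theorem mem_of_chase {s : Set Val} (hs : SupClosed s) (h₀ : ∀ t A, D₀ t A ∈ s)
    (h : Relation.ReflTransGen (ChaseStep sim (· ⊔ ·) Sgm) D₀ D) (t : Tid) (A : Attr) :
    D t A ∈ s := by
  induction h generalizing t A with
  | refl => exact h₀ t A
  | tail _ hstep ih =>
    obtain ⟨φ, -, σ, -, -, h0, h1, hrest⟩ := hstep
    by_cases hc : (t = σ (Sum.inl 0) ∧ A = φ.rhs.1) ∨ (t = σ (Sum.inl 1) ∧ A = φ.rhs.2)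
    · obtain ⟨rfl, rfl⟩ | ⟨rfl, rfl⟩ := hc
      · rw [h0]; exact hs (ih _ _) (ih _ _)
      · rw [h1]; exact hs (ih _ _) (ih _ _)
    · rw [hrest t A hc]; exact ih t A

theorem finite_setOf_chase [Finite Tid] [Finite Attr] (sim : Val → Val → Prop)
    (Sgm : Set (RelMD Attr)) (D₀ : Tid → Attr → Val) :
    {D | Relation.ReflTransGen (ChaseStep sim (· ⊔ ·) Sgm) D₀ D}.Finite := by
  have hfin : (supClosure (Set.range fun p : Tid × Attr => D₀ p.1 p.2)).Finite :=
    (Set.finite_range _).supClosure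
  refine (Set.Finite.pi' fun _ : Tid => Set.Finite.pi' fun _ : Attr => hfin).subset ?_
  intro D hD t A
  refine mem_of_chase supClosed_supClosure (fun t A => ?_) hD t A
  exact subset_supClosure ⟨(t, A), rfl⟩

theorem exists_clean [Finite Tid] [Finite Attr] (sim : Val → Val → Prop)
    (Sgm : Set (RelMD Attr)) (D₀ : Tid → Attr → Val) :
    ∃ D, Clean sim (· ⊔ ·) Sgm D₀ D := by
  obtain ⟨D, hD⟩ := (finite_setOf_chase sim Sgm D₀).exists_maximal
    ⟨D₀, Relation.ReflTransGen.refl⟩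
  refine ⟨D, hD.prop, fun φ hφ σ ⟨hσ, hne⟩ => ?_⟩
  obtain ⟨D', hD'⟩ := exists_enforceStep (· ⊔ ·) hσ hne
  have hstep : ChaseStep sim (· ⊔ ·) Sgm D D' := ⟨φ, hφ, hD'⟩
  exact hD.not_gt (hD.prop.tail hstep) hstep.lt

/-- A clean instance dominates every instance reachable by the chase. -/
theorem Clean.le_of_chase (hIF : InteractionFree Sgm) (hD : Clean sim (· ⊔ ·) Sgm D₀ D)
    (h : Relation.ReflTransGen (ChaseStep sim (· ⊔ ·) Sgm) D₀ D') : D' ≤ D := by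
  induction h with
  | refl => exact ERBlox.le_of_chase hD.1
  | tail hchase hstep ih =>
    obtain ⟨φ, hφ, σ, hσ, -, h0, h1, hrest⟩ := hstep
    have hσD : lhsHoldsOn sim φ D σ := (lhsHoldsOn_iff_of_chase hIF hD.1 hφ σ).2
      ((lhsHoldsOn_iff_of_chase hIF hchase hφ σ).1 hσ)
    have heq : D (σ (Sum.inl 0)) φ.rhs.1 = D (σ (Sum.inl 1)) φ.rhs.2 :=
      not_not.1 fun hne => hD.2 φ hφ σ ⟨hσD, hne⟩
    intro t A
    by_cases hc : (t = σ (Sum.inl 0) ∧ A = φ.rhs.1) ∨ (t = σ (Sum.inl 1) ∧ A = φ.rhs.2)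
    · obtain ⟨rfl, rfl⟩ | ⟨rfl, rfl⟩ := hc
      · rw [h0]; exact sup_le (ih _ _) ((ih _ _).trans heq.ge)
      · rw [h1]; exact sup_le ((ih _ _).trans heq.le) (ih _ _)
    · rw [hrest t A hc]; exact ih t A

theorem existsUnique_clean [Finite Tid] [Finite Attr] (hIF : InteractionFree Sgm)
    (D₀ : Tid → Attr → Val) : ∃! D, Clean sim (· ⊔ ·) Sgm D₀ D :=
  existsUnique_of_exists_of_unique (exists_clean sim Sgm D₀) fun _ _ h₁ h₂ =>
    le_antisymm (h₂.le_of_chase hIF h₁.1) (h₁.le_of_chase hIF h₂.1)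

end SemilatticeSup

/-- If a set of (relational) MDs is interaction-free, then for any
initial instance `D₀` there is a unique `(D₀,Sgm)`-clean instance. -/
theorem unique_clean_of_interaction_free
    {Tid Attr Val : Type} [Fintype Tid] [Fintype Attr]
    (sim : Val → Val → Prop) (m : Val → Val → Val)
    (hrefl : ∀ a, sim a a) (hsymm : ∀ a b, sim a b → sim b a)
    (hm : IsMatchingFn m)
    (Sgm : Set (RelMD Attr)) (hIF : InteractionFree Sgm)
    (D₀ : Tid → Attr → Val) :
    ∃! D : Tid → Attr → Val, Clean sim m Sgm D₀ D := by
  let _ : Max Val := ⟨m⟩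
  let _ : SemilatticeSup Val := SemilatticeSup.mk' hm.2.1 hm.2.2 hm.1
  exact existsUnique_clean hIF D₀

end ERBlox
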